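/- Let O be an LTL_horn^□○ ontology and A a data instance. Then: (i) for every basic temporal concept C and every n ∈ ℤ, n ∈ C^{C_{O,A}} iff C(n) ∈ C_{O,A}; (ii) for every model M of (O, A), every basic temporal concept C and every n ∈ ℤ, if C(n) ∈ C_{O,A} then n ∈ C^M; (iii) if ⊥ ∈ C_{O,A} then (O, A) has no model, and otherwise C_{O,A} is a model of (O, A); (iv) if (O, A) has a model, then for every positive temporal concept κ, ans^ℤ((O, κ), A) = κ^{C_{O,A}}. -/

import Mathlib

namespace LTLOMQ

/-! ## Temporal concepts (LTL formulas) and their semantics over (ℤ,<) -/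

/-- Temporal concepts: arbitrary LTL formulas over atomic concepts indexed by `ℕ`. -/
inductive TC : Type where
  | top : TC
  | atom : ℕ → TC
  | neg : TC → TC
  | and : TC → TC → TC
  | or : TC → TC → TC
  | nextF : TC → TC
  | diamF : TC → TC
  | boxF : TC → TC
  | untl : TC → TC → TC
  | nextP : TC → TC
  | diamP : TC → TC
  | boxP : TC → TC
  | since : TC → TC → TC

/-- A temporal interpretation assigns to each atomic concept a subset of ℤ. -/
abbrev Itp : Type := ℕ → Set ℤ

/-- The extension of a temporal concept in an interpretation
(strict semantics over `(ℤ,<)`). -/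
def TC.sem (M : Itp) : TC → Set ℤ
  | .top => Set.univ
  | .atom a => M a
  | .neg C => (TC.sem M C)ᶜ
  | .and C D => TC.sem M C ∩ TC.sem M D
  | .or C D => TC.sem M C ∪ TC.sem M D
  | .nextF C => {n | n + 1 ∈ TC.sem M C}
  | .diamF C => {n | ∃ k, n < k ∧ k ∈ TC.sem M C}
  | .boxF C => {n | ∀ k, n < k → k ∈ TC.sem M C}
  | .untl C D => {n | ∃ k, n < k ∧ k ∈ TC.sem M D ∧ ∀ m, n < m → m < k → m ∈ TC.sem M C}
  | .nextP C => {n | n - 1 ∈ TC.sem M C}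
  | .diamP C => {n | ∃ k, k < n ∧ k ∈ TC.sem M C}
  | .boxP C => {n | ∀ k, k < n → k ∈ TC.sem M C}
  | .since C D => {n | ∃ k, k < n ∧ k ∈ TC.sem M D ∧ ∀ m, k < m → m < n → m ∈ TC.sem M C}

/-- Basic temporal concepts: built from atomic concepts using ○F, ○P, □F, □P. -/
inductive TC.IsBasic : TC → Prop
  | atom (a : ℕ) : TC.IsBasic (.atom a)
  | nextF {C : TC} : TC.IsBasic C → TC.IsBasic (.nextF C)
  | nextP {C : TC} : TC.IsBasic C → TC.IsBasic (.nextP C)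
  | boxF {C : TC} : TC.IsBasic C → TC.IsBasic (.boxF C)
  | boxP {C : TC} : TC.IsBasic C → TC.IsBasic (.boxP C)

/-- Basic temporal concepts using □F and □P only. -/
inductive TC.IsBasicBox : TC → Prop
  | atom (a : ℕ) : TC.IsBasicBox (.atom a)
  | boxF {C : TC} : TC.IsBasicBox C → TC.IsBasicBox (.boxF C)
  | boxP {C : TC} : TC.IsBasicBox C → TC.IsBasicBox (.boxP C)

/-- Basic temporal concepts using ○F and ○P only. -/
inductive TC.IsBasicNext : TC → Prop
  | atom (a : ℕ) : TC.IsBasicNext (.atom a)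
  | nextF {C : TC} : TC.IsBasicNext C → TC.IsBasicNext (.nextF C)
  | nextP {C : TC} : TC.IsBasicNext C → TC.IsBasicNext (.nextP C)

/-- Positive temporal concepts: no occurrences of ¬. -/
inductive TC.IsPositive : TC → Prop
  | top : TC.IsPositive .top
  | atom (a : ℕ) : TC.IsPositive (.atom a)
  | and {C D : TC} : TC.IsPositive C → TC.IsPositive D → TC.IsPositive (.and C D)
  | or {C D : TC} : TC.IsPositive C → TC.IsPositive D → TC.IsPositive (.or C D)
  | nextF {C : TC} : TC.IsPositive C → TC.IsPositive (.nextF C)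
  | diamF {C : TC} : TC.IsPositive C → TC.IsPositive (.diamF C)
  | boxF {C : TC} : TC.IsPositive C → TC.IsPositive (.boxF C)
  | untl {C D : TC} : TC.IsPositive C → TC.IsPositive D → TC.IsPositive (.untl C D)
  | nextP {C : TC} : TC.IsPositive C → TC.IsPositive (.nextP C)
  | diamP {C : TC} : TC.IsPositive C → TC.IsPositive (.diamP C)
  | boxP {C : TC} : TC.IsPositive C → TC.IsPositive (.boxP C)
  | since {C D : TC} : TC.IsPositive C → TC.IsPositive D → TC.IsPositive (.since C D)

/-- Prior-LTL formulas: Boolean connectives and □P, ◇P, □F, ◇F only. -/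
inductive TC.IsPrior : TC → Prop
  | atom (a : ℕ) : TC.IsPrior (.atom a)
  | neg {C : TC} : TC.IsPrior C → TC.IsPrior (.neg C)
  | and {C D : TC} : TC.IsPrior C → TC.IsPrior D → TC.IsPrior (.and C D)
  | or {C D : TC} : TC.IsPrior C → TC.IsPrior D → TC.IsPrior (.or C D)
  | boxF {C : TC} : TC.IsPrior C → TC.IsPrior (.boxF C)
  | boxP {C : TC} : TC.IsPrior C → TC.IsPrior (.boxP C)
  | diamF {C : TC} : TC.IsPrior C → TC.IsPrior (.diamF C)
  | diamP {C : TC} : TC.IsPrior C → TC.IsPrior (.diamP C)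

/-- Number of occurrences of temporal operators in a temporal concept. -/
def TC.tempOps : TC → ℕ
  | .top => 0
  | .atom _ => 0
  | .neg C => TC.tempOps C
  | .and C D => TC.tempOps C + TC.tempOps D
  | .or C D => TC.tempOps C + TC.tempOps D
  | .nextF C => TC.tempOps C + 1
  | .diamF C => TC.tempOps C + 1
  | .boxF C => TC.tempOps C + 1
  | .untl C D => TC.tempOps C + TC.tempOps D + 1
  | .nextP C => TC.tempOps C + 1
  | .diamP C => TC.tempOps C + 1
  | .boxP C => TC.tempOps C + 1
  | .since C D => TC.tempOps C + TC.tempOps D + 1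

/-- Number of occurrences of symbols in a temporal concept. -/
def TC.size : TC → ℕ
  | .top => 1
  | .atom _ => 1
  | .neg C => TC.size C + 1
  | .and C D => TC.size C + TC.size D + 1
  | .or C D => TC.size C + TC.size D + 1
  | .nextF C => TC.size C + 1
  | .diamF C => TC.size C + 1
  | .boxF C => TC.size C + 1
  | .untl C D => TC.size C + TC.size D + 1
  | .nextP C => TC.size C + 1
  | .diamP C => TC.size C + 1
  | .boxP C => TC.size C + 1
  | .since C D => TC.size C + TC.size D + 1

/-- The set of subconcepts of a temporal concept. -/
def TC.subs : TC → Set TC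
  | .top => {.top}
  | .atom a => {.atom a}
  | .neg C => insert (.neg C) (TC.subs C)
  | .and C D => insert (.and C D) (TC.subs C ∪ TC.subs D)
  | .or C D => insert (.or C D) (TC.subs C ∪ TC.subs D)
  | .nextF C => insert (.nextF C) (TC.subs C)
  | .diamF C => insert (.diamF C) (TC.subs C)
  | .boxF C => insert (.boxF C) (TC.subs C)
  | .untl C D => insert (.untl C D) (TC.subs C ∪ TC.subs D)
  | .nextP C => insert (.nextP C) (TC.subs C)
  | .diamP C => insert (.diamP C) (TC.subs C)
  | .boxP C => insert (.boxP C) (TC.subs C)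
  | .since C D => insert (.since C D) (TC.subs C ∪ TC.subs D)

/-- The set of atomic concepts occurring in a temporal concept. -/
def TC.atoms : TC → Set ℕ
  | .top => ∅
  | .atom a => {a}
  | .neg C => TC.atoms C
  | .and C D => TC.atoms C ∪ TC.atoms D
  | .or C D => TC.atoms C ∪ TC.atoms D
  | .nextF C => TC.atoms C
  | .diamF C => TC.atoms C
  | .boxF C => TC.atoms C
  | .untl C D => TC.atoms C ∪ TC.atoms D
  | .nextP C => TC.atoms C
  | .diamP C => TC.atoms C
  | .boxP C => TC.atoms C
  | .since C D => TC.atoms C ∪ TC.atoms D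

/-! ## Clauses, ontologies, data instances -/

/-- A clause `C₁ ∧ … ∧ C_k → C_{k+1} ∨ … ∨ C_{k+m}`. -/
structure Clause : Type where
  prem : List TC
  concl : List TC

/-- A clause is true in `M` if the intersection of the extensions of the premises
is contained in the union of the extensions of the conclusions. -/
def Clause.holds (M : Itp) (cl : Clause) : Prop :=
  ∀ n : ℤ, (∀ C ∈ cl.prem, n ∈ TC.sem M C) → ∃ C ∈ cl.concl, n ∈ TC.sem M C

/-- An ontology is a finite set (list) of clauses. -/
abbrev Ontology : Type := List Clause

def Clause.AllBasic (cl : Clause) : Prop :=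
  (∀ C ∈ cl.prem, C.IsBasic) ∧ (∀ C ∈ cl.concl, C.IsBasic)

def Clause.AllBasicBox (cl : Clause) : Prop :=
  (∀ C ∈ cl.prem, C.IsBasicBox) ∧ (∀ C ∈ cl.concl, C.IsBasicBox)

def Clause.AllBasicNext (cl : Clause) : Prop :=
  (∀ C ∈ cl.prem, C.IsBasicNext) ∧ (∀ C ∈ cl.concl, C.IsBasicNext)

/-- Horn: at most one disjunct in the conclusion. -/
def Clause.Horn (cl : Clause) : Prop := cl.concl.length ≤ 1

/-- Krom (binary): at most two concepts altogether. -/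
def Clause.Krom (cl : Clause) : Prop := cl.prem.length + cl.concl.length ≤ 2

/-- LTL_bool^□○ ontologies. -/
def Ontology.BoolBoxNext (O : Ontology) : Prop := ∀ cl ∈ O, cl.AllBasic
/-- LTL_bool^□ ontologies. -/
def Ontology.BoolBox (O : Ontology) : Prop := ∀ cl ∈ O, cl.AllBasicBox
/-- LTL_krom^○ ontologies. -/
def Ontology.KromNext (O : Ontology) : Prop := ∀ cl ∈ O, cl.AllBasicNext ∧ cl.Krom
/-- LTL_krom^□○ ontologies. -/
def Ontology.KromBoxNext (O : Ontology) : Prop := ∀ cl ∈ O, cl.AllBasic ∧ cl.Krom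
/-- LTL_horn^□○ ontologies. -/
def Ontology.HornBoxNext (O : Ontology) : Prop := ∀ cl ∈ O, cl.AllBasic ∧ cl.Horn
/-- LTL_horn^□ ontologies. -/
def Ontology.HornBox (O : Ontology) : Prop := ∀ cl ∈ O, cl.AllBasicBox ∧ cl.Horn
/-- LTL_core^□○ ontologies. -/
def Ontology.CoreBoxNext (O : Ontology) : Prop := ∀ cl ∈ O, cl.AllBasic ∧ cl.Horn ∧ cl.Krom

/-- Number of occurrences of symbols in a clause. -/
def Clause.size (cl : Clause) : ℕ :=
  (cl.prem.map TC.size).sum + (cl.concl.map TC.size).sum + 1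

/-- Number of occurrences of symbols in an ontology. -/
def Ontology.size (O : Ontology) : ℕ := (O.map Clause.size).sum

/-- The atomic concept `a` occurs in the ontology `O`. -/
def Ontology.occurs (O : Ontology) (a : ℕ) : Prop :=
  ∃ cl ∈ O, (∃ C ∈ cl.prem, a ∈ C.atoms) ∨ (∃ C ∈ cl.concl, a ∈ C.atoms)

/-- The set of subconcepts of (concepts occurring in) an ontology. -/
def Ontology.subs (O : Ontology) : Set TC :=
  {C | ∃ cl ∈ O, ∃ D : TC, (D ∈ cl.prem ∨ D ∈ cl.concl) ∧ C ∈ D.subs}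

/-- A flat concept: an atomic concept, or a single ○F or ○P applied to an atomic concept. -/
def TC.IsFlat : TC → Prop
  | .atom _ => True
  | .nextF (.atom _) => True
  | .nextP (.atom _) => True
  | _ => False

/-- An ontology without nested temporal operators. -/
def Ontology.Flat (O : Ontology) : Prop :=
  ∀ cl ∈ O, (∀ C ∈ cl.prem, C.IsFlat) ∧ (∀ C ∈ cl.concl, C.IsFlat)

/-- A data instance: a finite nonempty set of timestamped atoms, normalized so that
the minimal timestamp is 0 and the maximal one is ≥ 1. -/
structure DataInstance : Type where
  atoms : Finset (ℕ × ℤ)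
  nonneg : ∀ p ∈ atoms, 0 ≤ p.2
  has_zero : ∃ p ∈ atoms, p.2 = 0
  has_one : ∃ p ∈ atoms, 1 ≤ p.2

theorem DataInstance.ts_nonempty (A : DataInstance) :
    (A.atoms.image Prod.snd).Nonempty := by
  obtain ⟨p, hp, -⟩ := A.has_zero
  exact ⟨p.2, Finset.mem_image_of_mem _ hp⟩

/-- min A: the minimal timestamp occurring in the data instance (equal to 0). -/
def DataInstance.minT (A : DataInstance) : ℤ :=
  (A.atoms.image Prod.snd).min' A.ts_nonempty

/-- max A: the maximal timestamp occurring in the data instance. -/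
def DataInstance.maxT (A : DataInstance) : ℤ :=
  (A.atoms.image Prod.snd).max' A.ts_nonempty

/-- The active temporal domain tem(A). -/
def DataInstance.tem (A : DataInstance) : Set ℤ := Set.Icc A.minT A.maxT

/-- The interpretation of atomic concepts in the first-order structure S_A. -/
def DataInstance.itp (A : DataInstance) : Itp := fun a => {n | (a, n) ∈ A.atoms}

/-- `M` is a model of the knowledge base `(O, A)`. -/
def IsModel (M : Itp) (O : Ontology) (A : DataInstance) : Prop :=
  (∀ cl ∈ O, cl.holds M) ∧ ∀ p ∈ A.atoms, p.2 ∈ M p.1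

/-- The ontology `O` is consistent. -/
def Ontology.Consistent (O : Ontology) : Prop := ∃ M : Itp, ∀ cl ∈ O, cl.holds M

/-- The data instance `A` is consistent with `O`. -/
def ConsistentWith (O : Ontology) (A : DataInstance) : Prop := ∃ M : Itp, IsModel M O A

/-- Certain answers to the OMIQ `(O, κ)` over `A` (within the active domain). -/
def certAns (O : Ontology) (κ : TC) (A : DataInstance) : Set ℤ :=
  {ℓ | ℓ ∈ A.tem ∧ ∀ M : Itp, IsModel M O A → ℓ ∈ TC.sem M κ}

/-- Certain answers to the OMIQ `(O, κ)` over `A` and ℤ. -/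
def certAnsZ (O : Ontology) (κ : TC) (A : DataInstance) : Set ℤ :=
  {ℓ | ∀ M : Itp, IsModel M O A → ℓ ∈ TC.sem M κ}

/-! ## First-order, MSO and FO(RPR) formulas over the temporal structures -/

/-- Formulas of the target languages: first-order variables are indexed by `ℕ`,
as are second-order (set) variables and the recursively defined relation variables
of FO(RPR).  The constructors `qprev j` and `qapp j x` stand for `Q_j(t-1)` (inside
a recursive definition block) and `Q_j(x)`, respectively; `rpr n Θ tv ψ` is the
relational-primitive-recursion construct `[Q₁(t) ≡ Θ₁; …; Q_n(t) ≡ Θ_n] ψ`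
with recursion variable `tv`. -/
inductive Fml : Type where
  | falsum : Fml
  | atom : ℕ → ℕ → Fml        -- A(x)
  | lt : ℕ → ℕ → Fml          -- x < y
  | eq : ℕ → ℕ → Fml          -- x = y
  | succ : ℕ → ℕ → Fml        -- x = y + 1
  | mod : ℕ → ℕ → Fml         -- x ≡ 0 (mod n)
  | svar : ℕ → ℕ → Fml        -- X(x), X a set variable
  | qprev : ℕ → Fml           -- Q_j(t−1)
  | qapp : ℕ → ℕ → Fml        -- Q_j(x)
  | neg : Fml → Fml
  | and : Fml → Fml → Fml
  | or : Fml → Fml → Fml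
  | ex : ℕ → Fml → Fml
  | all : ℕ → Fml → Fml
  | exS : ℕ → Fml → Fml       -- second-order ∃
  | allS : ℕ → Fml → Fml      -- second-order ∀
  | rpr : (n : ℕ) → (Fin n → Fml) → ℕ → Fml → Fml

/-- Evaluation of a formula over the structure with (active) domain `D ⊆ ℤ`
and interpretation `I` of the unary predicates; `env` assigns first-order
variables, `senv` set variables, `prev` the placeholders `Q_j(t-1)` and
`Q` the defined relation variables. First-order quantifiers range over `D`,
second-order quantifiers over subsets of `D`. -/
def Fml.eval (D : Set ℤ) (I : ℕ → Set ℤ) :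
    Fml → (ℕ → ℤ) → (ℕ → Set ℤ) → (ℕ → Prop) → (ℕ → ℤ → Prop) → Prop
  | .falsum, _, _, _, _ => False
  | .atom a x, env, _, _, _ => env x ∈ I a
  | .lt x y, env, _, _, _ => env x < env y
  | .eq x y, env, _, _, _ => env x = env y
  | .succ x y, env, _, _, _ => env x = env y + 1
  | .mod n x, env, _, _, _ => (n : ℤ) ∣ env x
  | .svar X x, env, senv, _, _ => env x ∈ senv X
  | .qprev j, _, _, prev, _ => prev j
  | .qapp j x, env, _, _, Q => Q j (env x)
  | .neg φ, env, senv, prev, Q => ¬ Fml.eval D I φ env senv prev Q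
  | .and φ ψ, env, senv, prev, Q =>
      Fml.eval D I φ env senv prev Q ∧ Fml.eval D I ψ env senv prev Q
  | .or φ ψ, env, senv, prev, Q =>
      Fml.eval D I φ env senv prev Q ∨ Fml.eval D I ψ env senv prev Q
  | .ex x φ, env, senv, prev, Q =>
      ∃ d ∈ D, Fml.eval D I φ (Function.update env x d) senv prev Q
  | .all x φ, env, senv, prev, Q =>
      ∀ d ∈ D, Fml.eval D I φ (Function.update env x d) senv prev Q
  | .exS X φ, env, senv, prev, Q =>
      ∃ S : Set ℤ, S ⊆ D ∧ Fml.eval D I φ env (Function.update senv X S) prev Q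
  | .allS X φ, env, senv, prev, Q =>
      ∀ S : Set ℤ, S ⊆ D → Fml.eval D I φ env (Function.update senv X S) prev Q
  | .rpr n Θ tv ψ, env, senv, prev, Q =>
      -- the semantics of each Θ_j, as a function of the first-order environment
      -- and of the truth values of the `Q_j(t−1)` placeholders
      let f : Fin n → (ℕ → ℤ) → (ℕ → Prop) → Prop :=
        fun j env' prev' => Fml.eval D I (Θ j) env' senv prev' Q
      -- the recursively computed truth values of `Q_j` at time `k` (recursion on k from 0)
      let recQ : ℕ → Fin n → Prop := fun k =>
        Nat.rec (fun j => f j (Function.update env tv 0) (fun _ => False))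
          (fun m ih j => f j (Function.update env tv ((m : ℤ) + 1))
            (fun i => ∃ h : i < n, ih ⟨i, h⟩)) k
      Fml.eval D I ψ env senv prev
        (fun j z => ∃ h : j < n, 0 ≤ z ∧ recQ z.toNat ⟨j, h⟩)

/-- Free first-order variables of a formula. -/
def Fml.fvars : Fml → Set ℕ
  | .falsum => ∅
  | .atom _ x => {x}
  | .lt x y => {x, y}
  | .eq x y => {x, y}
  | .succ x y => {x, y}
  | .mod _ x => {x}
  | .svar _ x => {x}
  | .qprev _ => ∅
  | .qapp _ x => {x}
  | .neg φ => Fml.fvars φ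
  | .and φ ψ => Fml.fvars φ ∪ Fml.fvars ψ
  | .or φ ψ => Fml.fvars φ ∪ Fml.fvars ψ
  | .ex x φ => Fml.fvars φ \ {x}
  | .all x φ => Fml.fvars φ \ {x}
  | .exS _ φ => Fml.fvars φ
  | .allS _ φ => Fml.fvars φ
  | .rpr n Θ tv ψ => (⋃ j : Fin n, Fml.fvars (Θ j) \ {tv}) ∪ Fml.fvars ψ

/-- FO(<)-formulas: first-order logic with the built-in linear order
(and the definable equality predicate); no constants, no arithmetic. -/
def Fml.IsFOlt : Fml → Prop
  | .falsum => True
  | .atom _ _ => True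
  | .lt _ _ => True
  | .eq _ _ => True
  | .neg φ => Fml.IsFOlt φ
  | .and φ ψ => Fml.IsFOlt φ ∧ Fml.IsFOlt ψ
  | .or φ ψ => Fml.IsFOlt φ ∧ Fml.IsFOlt ψ
  | .ex _ φ => Fml.IsFOlt φ
  | .all _ φ => Fml.IsFOlt φ
  | _ => False

/-- FO(<,≡)-formulas: FO(<) extended with the predicates `t ≡ 0 (mod n)`, `n > 1`. -/
def Fml.IsFOltMod : Fml → Prop
  | .falsum => True
  | .atom _ _ => True
  | .lt _ _ => True
  | .eq _ _ => True
  | .mod n _ => 2 ≤ n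
  | .neg φ => Fml.IsFOltMod φ
  | .and φ ψ => Fml.IsFOltMod φ ∧ Fml.IsFOltMod ψ
  | .or φ ψ => Fml.IsFOltMod φ ∧ Fml.IsFOltMod ψ
  | .ex _ φ => Fml.IsFOltMod φ
  | .all _ φ => Fml.IsFOltMod φ
  | _ => False

/-- MSO(<)-formulas: FO(<) extended with set variables and second-order quantifiers. -/
def Fml.IsMSO : Fml → Prop
  | .falsum => True
  | .atom _ _ => True
  | .lt _ _ => True
  | .eq _ _ => True
  | .svar _ _ => True
  | .neg φ => Fml.IsMSO φ
  | .and φ ψ => Fml.IsMSO φ ∧ Fml.IsMSO ψ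
  | .or φ ψ => Fml.IsMSO φ ∧ Fml.IsMSO ψ
  | .ex _ φ => Fml.IsMSO φ
  | .all _ φ => Fml.IsMSO φ
  | .exS _ φ => Fml.IsMSO φ
  | .allS _ φ => Fml.IsMSO φ
  | _ => False

/-- FO(RPR)-formulas: FO(<) extended with successor and relational primitive recursion. -/
def Fml.IsRPR : Fml → Prop
  | .falsum => True
  | .atom _ _ => True
  | .lt _ _ => True
  | .eq _ _ => True
  | .succ _ _ => True
  | .qprev _ => True
  | .qapp _ _ => True
  | .neg φ => Fml.IsRPR φ
  | .and φ ψ => Fml.IsRPR φ ∧ Fml.IsRPR ψ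
  | .or φ ψ => Fml.IsRPR φ ∧ Fml.IsRPR ψ
  | .ex _ φ => Fml.IsRPR φ
  | .all _ φ => Fml.IsRPR φ
  | .rpr n Θ _ ψ => (∀ j : Fin n, Fml.IsRPR (Θ j)) ∧ Fml.IsRPR ψ
  | _ => False

/-- MFO(<)-formulas: monadic first-order formulas built from atoms `A(t)`,
`t < t'`, `t = t'` and `t = t' + 1`. -/
def Fml.IsMFO : Fml → Prop
  | .falsum => True
  | .atom _ _ => True
  | .lt _ _ => True
  | .eq _ _ => True
  | .succ _ _ => True
  | .neg φ => Fml.IsMFO φ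
  | .and φ ψ => Fml.IsMFO φ ∧ Fml.IsMFO ψ
  | .or φ ψ => Fml.IsMFO φ ∧ Fml.IsMFO ψ
  | .ex _ φ => Fml.IsMFO φ
  | .all _ φ => Fml.IsMFO φ
  | _ => False

/-- Quasi-positive MFO(<)-formulas: built from atoms `A(t)`, `t < t'`, `t = t'`,
`t = t' + 1` (and ⊥) using ∧, ∨, ∃, ∀ as well as guarded universal quantification
`∀y (x < y < z → φ)`, `∀y (x < y → φ)`, `∀y (y < z → φ)`
(the guarded implications are encoded via `¬guard ∨ φ`). -/
inductive Fml.IsQP : Fml → Prop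
  | falsum : Fml.IsQP .falsum
  | atom (a x : ℕ) : Fml.IsQP (.atom a x)
  | lt (x y : ℕ) : Fml.IsQP (.lt x y)
  | eq (x y : ℕ) : Fml.IsQP (.eq x y)
  | succ (x y : ℕ) : Fml.IsQP (.succ x y)
  | and {φ ψ : Fml} : Fml.IsQP φ → Fml.IsQP ψ → Fml.IsQP (.and φ ψ)
  | or {φ ψ : Fml} : Fml.IsQP φ → Fml.IsQP ψ → Fml.IsQP (.or φ ψ)
  | ex (x : ℕ) {φ : Fml} : Fml.IsQP φ → Fml.IsQP (.ex x φ)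
  | all (x : ℕ) {φ : Fml} : Fml.IsQP φ → Fml.IsQP (.all x φ)
  | allBtw (y x z : ℕ) {φ : Fml} : Fml.IsQP φ →
      Fml.IsQP (.all y (.or (.neg (.and (.lt x y) (.lt y z))) φ))
  | allGt (y x : ℕ) {φ : Fml} : Fml.IsQP φ →
      Fml.IsQP (.all y (.or (.neg (.lt x y)) φ))
  | allLt (y z : ℕ) {φ : Fml} : Fml.IsQP φ →
      Fml.IsQP (.all y (.or (.neg (.lt y z)) φ))

/-- Evaluation in a structure with domain `D` and unary predicates `I`
(no set variables, placeholders or relation variables supplied). -/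
def Fml.evalIn (D : Set ℤ) (I : Itp) (φ : Fml) (env : ℕ → ℤ) : Prop :=
  Fml.eval D I φ env (fun _ => ∅) (fun _ => False) (fun _ _ => False)

/-- An MFO(<)-formula is monotone if it is preserved under adding time points
to the extensions of the atomic concepts. -/
def MonotoneFml (ψ : Fml) : Prop :=
  ∀ M₁ M₂ : Itp, (∀ a : ℕ, M₁ a ⊆ M₂ a) → ∀ env : ℕ → ℤ,
    Fml.evalIn Set.univ M₁ ψ env → Fml.evalIn Set.univ M₂ ψ env

/-! ## The canonical model of a Horn ontology and a data instance -/

/-- Atoms of the closure: ⊥ or `C(n)` for a (basic) temporal concept `C` and `n ∈ ℤ`. -/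
inductive EAtom : Type where
  | bot : EAtom
  | conc : TC → ℤ → EAtom

/-- One (non-recursive) application of the closure rules of the canonical model. -/
def clStep (O : Ontology) (Λ : Set EAtom) : Set EAtom :=
  Λ ∪
  {e | ∃ cl ∈ O, ∃ n : ℤ, (∀ C ∈ cl.prem, EAtom.conc C n ∈ Λ) ∧
        ((∃ C : TC, cl.concl = [C] ∧ e = EAtom.conc C n) ∨
          (cl.concl = [] ∧ e = EAtom.bot))} ∪
  {e | ∃ C : TC, ∃ n k : ℤ, n < k ∧ EAtom.conc (.boxF C) n ∈ Λ ∧ e = EAtom.conc C k} ∪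
  {e | ∃ C : TC, ∃ n : ℤ, (∀ k : ℤ, n < k → EAtom.conc C k ∈ Λ) ∧
        e = EAtom.conc (.boxF C) n} ∪
  {e | ∃ C : TC, ∃ n : ℤ, EAtom.conc (.nextF C) n ∈ Λ ∧ e = EAtom.conc C (n + 1)} ∪
  {e | ∃ C : TC, ∃ n : ℤ, EAtom.conc C (n + 1) ∈ Λ ∧ e = EAtom.conc (.nextF C) n} ∪
  {e | ∃ C : TC, ∃ n k : ℤ, k < n ∧ EAtom.conc (.boxP C) n ∈ Λ ∧ e = EAtom.conc C k} ∪
  {e | ∃ C : TC, ∃ n : ℤ, (∀ k : ℤ, k < n → EAtom.conc C k ∈ Λ) ∧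
        e = EAtom.conc (.boxP C) n} ∪
  {e | ∃ C : TC, ∃ n : ℤ, EAtom.conc (.nextP C) n ∈ Λ ∧ e = EAtom.conc C (n - 1)} ∪
  {e | ∃ C : TC, ∃ n : ℤ, EAtom.conc C (n - 1) ∈ Λ ∧ e = EAtom.conc (.nextP C) n}

/-- Transfinite iteration of the closure rules. -/
noncomputable def clIter (O : Ontology) (Λ : Set EAtom) (o : Ordinal.{0}) : Set EAtom :=
  Ordinal.limitRecOn o Λ (fun _ ih => clStep O ih)
    (fun o _ ih => ⋃ (o' : Ordinal.{0}), ⋃ (h : o' < o), ih o' h)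

/-- The atoms of a data instance, as a set of closure atoms. -/
def dataAtoms (A : DataInstance) : Set EAtom :=
  {e | ∃ p ∈ A.atoms, e = EAtom.conc (.atom p.1) p.2}

open Ordinal in
/-- The canonical model `C_{O,A}`: the closure of `A` under the rules,
iterated up to the first uncountable ordinal ω₁. -/
noncomputable def canon (O : Ontology) (A : DataInstance) : Set EAtom :=
  clIter O (dataAtoms A) (Ordinal.omega 1)

/-- The canonical model regarded as a temporal interpretation. -/
noncomputable def canonItp (O : Ontology) (A : DataInstance) : Itp :=
  fun a => {n | EAtom.conc (.atom a) n ∈ canon O A}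

/-- The type `τ_{O,A}(n)`: the set of subconcepts of `O` that hold at `n`
in the canonical model. -/
noncomputable def tau (O : Ontology) (A : DataInstance) (n : ℤ) : Set TC :=
  {C ∈ O.subs | n ∈ TC.sem (canonItp O A) C}

/-! ## Literals and the reachability relation ⇝ for Krom ontologies -/

/-- A simple literal: an atomic concept with a polarity. -/
abbrev Lit : Type := ℕ × Bool

/-- The temporal concept corresponding to a literal. -/
def Lit.toTC (L : Lit) : TC := if L.2 then .atom L.1 else .neg (.atom L.1)

def TC.iterF : ℕ → TC → TC
  | 0, C => C
  | k + 1, C => .nextF (TC.iterF k C)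

def TC.iterP : ℕ → TC → TC
  | 0, C => C
  | k + 1, C => .nextP (TC.iterP k C)

/-- `○^k C`: `k` occurrences of ○F if `k > 0`, of ○P if `k < 0`. -/
def TC.shift (k : ℤ) (C : TC) : TC :=
  if 0 ≤ k then TC.iterF k.toNat C else TC.iterP (-k).toNat C

/-- `(L₁,n₁) ⇝ (L₂,n₂)`: in every model of `O`,
`(○^{n₁} L₁)^M ⊆ (○^{n₂} L₂)^M`. -/
def leadsTo (O : Ontology) (L₁ : Lit) (n₁ : ℤ) (L₂ : Lit) (n₂ : ℤ) : Prop :=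
  ∀ M : Itp, (∀ cl ∈ O, cl.holds M) →
    TC.sem M (TC.shift n₁ L₁.toTC) ⊆ TC.sem M (TC.shift n₂ L₂.toTC)


/-! ## The closure up to `ω₁` is a fixed point of the closure rules -/

open Ordinal in
theorem clIter_zero (O : Ontology) (Λ : Set EAtom) : clIter O Λ 0 = Λ :=
  limitRecOn_zero ..

open Ordinal in
theorem clIter_add_one (O : Ontology) (Λ : Set EAtom) (o : Ordinal.{0}) :
    clIter O Λ (o + 1) = clStep O (clIter O Λ o) :=
  limitRecOn_add_one ..

open Ordinal in
theorem mem_clIter_limit {O : Ontology} {Λ : Set EAtom} {o : Ordinal.{0}}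
    (ho : Order.IsSuccLimit o) {e : EAtom} :
    e ∈ clIter O Λ o ↔ ∃ o' < o, e ∈ clIter O Λ o' := by
  have h : clIter O Λ o = ⋃ (o' : Ordinal.{0}), ⋃ (_ : o' < o), clIter O Λ o' :=
    limitRecOn_limit _ _ _ _ ho
  simp [h]

theorem subset_clStep (O : Ontology) (Λ : Set EAtom) : Λ ⊆ clStep O Λ := by
  intro e he
  iterate 9 left
  exact he

open Ordinal in
theorem clIter_mono (O : Ontology) (Λ : Set EAtom) : Monotone (clIter O Λ) := by
  intro o₁ o₂ h
  induction o₂ using limitRecOn with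
  | zero => rw [nonpos_iff_eq_zero.1 h]
  | add_one o ih =>
    rcases h.eq_or_lt with rfl | h
    · exact le_rfl
    · rw [clIter_add_one]
      exact (ih (Order.lt_add_one_iff.1 h)).trans (subset_clStep O _)
  | limit o ho ih =>
    rcases h.eq_or_lt with rfl | h
    · exact le_rfl
    · exact fun e he => (mem_clIter_limit ho).2 ⟨o₁, h, he⟩

open Ordinal in
theorem isSuccLimit_omega_one : Order.IsSuccLimit (omega.{0} 1) := by
  rw [← Cardinal.ord_aleph]
  exact Cardinal.isSuccLimit_ord (Cardinal.aleph0_le_aleph 1)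

open Ordinal in
theorem mem_canon {O : Ontology} {A : DataInstance} {e : EAtom} :
    e ∈ canon O A ↔ ∃ o < omega 1, e ∈ clIter O (dataAtoms A) o :=
  mem_clIter_limit isSuccLimit_omega_one

open Ordinal in
/-- A rule with countably many premises in the canonical model has its conclusion there. -/
theorem mem_canon_of_countable {O : Ontology} {A : DataInstance} {e : EAtom} {S : Set EAtom}
    (hS : S.Countable) (hSA : S ⊆ canon O A) (he : ∀ Λ, S ⊆ Λ → e ∈ clStep O Λ) :
    e ∈ canon O A := by
  choose! f hf hfS using fun s (hs : s ∈ S) => mem_canon.1 (hSA hs)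
  have : Countable S := hS
  have hlt : ⨆ s : S, f s < omega 1 := iSup_lt_omega_one fun s => hf s s.2
  refine mem_canon.2 ⟨_, isSuccLimit_omega_one.add_one_lt hlt, ?_⟩
  rw [clIter_add_one]
  exact he _ fun s hs => clIter_mono _ _ (Ordinal.le_iSup (fun s : S => f s) ⟨s, hs⟩) (hfS s hs)

theorem mem_canon_of_mem_dataAtoms {O : Ontology} {A : DataInstance} {e : EAtom}
    (he : e ∈ dataAtoms A) : e ∈ canon O A :=
  mem_canon.2 ⟨0, Ordinal.omega_pos 1, by rwa [clIter_zero]⟩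

theorem countable_conc_prem (cl : Clause) (n : ℤ) :
    {e | ∃ C ∈ cl.prem, e = EAtom.conc C n}.Countable := by
  have h : {e | ∃ C ∈ cl.prem, e = EAtom.conc C n} =
      (fun C => EAtom.conc C n) '' {C | C ∈ cl.prem} := by
    ext e
    simp [eq_comm]
  rw [h]
  exact (List.finite_toSet cl.prem).countable.image _

section Rules

variable {O : Ontology} {A : DataInstance} {C : TC} {n : ℤ}

theorem conc_mem_canon_of_clause {cl : Clause} (hcl : cl ∈ O) (hC : cl.concl = [C])
    (h : ∀ D ∈ cl.prem, EAtom.conc D n ∈ canon O A) : EAtom.conc C n ∈ canon O A := by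
  refine mem_canon_of_countable (countable_conc_prem cl n) ?_ fun Λ hΛ => ?_
  · rintro _ ⟨D, hD, rfl⟩
    exact h D hD
  · iterate 8 left
    exact Or.inr ⟨cl, hcl, n, fun D hD => hΛ ⟨D, hD, rfl⟩, Or.inl ⟨C, hC, rfl⟩⟩

theorem bot_mem_canon_of_clause {cl : Clause} (hcl : cl ∈ O) (hC : cl.concl = [])
    (h : ∀ D ∈ cl.prem, EAtom.conc D n ∈ canon O A) : EAtom.bot ∈ canon O A := by
  refine mem_canon_of_countable (countable_conc_prem cl n) ?_ fun Λ hΛ => ?_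
  · rintro _ ⟨D, hD, rfl⟩
    exact h D hD
  · iterate 8 left
    exact Or.inr ⟨cl, hcl, n, fun D hD => hΛ ⟨D, hD, rfl⟩, Or.inr ⟨hC, rfl⟩⟩

theorem boxF_mem_canon :
    EAtom.conc (.boxF C) n ∈ canon O A ↔ ∀ k, n < k → EAtom.conc C k ∈ canon O A := by
  refine ⟨fun h k hk => mem_canon_of_countable (Set.countable_singleton _)
    (Set.singleton_subset_iff.2 h) fun Λ hΛ => ?_,
    fun h => mem_canon_of_countable ((Set.to_countable (Set.Ioi n)).image (EAtom.conc C))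
    (Set.image_subset_iff.2 h) fun Λ hΛ => ?_⟩
  · iterate 7 left
    exact Or.inr ⟨C, n, k, hk, hΛ rfl, rfl⟩
  · iterate 6 left
    exact Or.inr ⟨C, n, fun k hk => hΛ ⟨k, hk, rfl⟩, rfl⟩

theorem nextF_mem_canon :
    EAtom.conc (.nextF C) n ∈ canon O A ↔ EAtom.conc C (n + 1) ∈ canon O A := by
  refine ⟨fun h => mem_canon_of_countable (Set.countable_singleton _)
    (Set.singleton_subset_iff.2 h) fun Λ hΛ => ?_,
    fun h => mem_canon_of_countable (Set.countable_singleton _)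
    (Set.singleton_subset_iff.2 h) fun Λ hΛ => ?_⟩
  · iterate 5 left
    exact Or.inr ⟨C, n, hΛ rfl, rfl⟩
  · iterate 4 left
    exact Or.inr ⟨C, n, hΛ rfl, rfl⟩

theorem boxP_mem_canon :
    EAtom.conc (.boxP C) n ∈ canon O A ↔ ∀ k, k < n → EAtom.conc C k ∈ canon O A := by
  refine ⟨fun h k hk => mem_canon_of_countable (Set.countable_singleton _)
    (Set.singleton_subset_iff.2 h) fun Λ hΛ => ?_,
    fun h => mem_canon_of_countable ((Set.to_countable (Set.Iio n)).image (EAtom.conc C))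
    (Set.image_subset_iff.2 h) fun Λ hΛ => ?_⟩
  · iterate 3 left
    exact Or.inr ⟨C, n, k, hk, hΛ rfl, rfl⟩
  · iterate 2 left
    exact Or.inr ⟨C, n, fun k hk => hΛ ⟨k, hk, rfl⟩, rfl⟩

theorem nextP_mem_canon :
    EAtom.conc (.nextP C) n ∈ canon O A ↔ EAtom.conc C (n - 1) ∈ canon O A := by
  refine ⟨fun h => mem_canon_of_countable (Set.countable_singleton _)
    (Set.singleton_subset_iff.2 h) fun Λ hΛ => ?_,
    fun h => mem_canon_of_countable (Set.countable_singleton _)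
    (Set.singleton_subset_iff.2 h) fun Λ hΛ => ?_⟩
  · left
    exact Or.inr ⟨C, n, hΛ rfl, rfl⟩
  · exact Or.inr ⟨C, n, hΛ rfl, rfl⟩

end Rules

theorem mem_sem_canonItp_iff (O : Ontology) (A : DataInstance) {C : TC} (hC : C.IsBasic) (n : ℤ) :
    n ∈ TC.sem (canonItp O A) C ↔ EAtom.conc C n ∈ canon O A := by
  induction hC generalizing n with
  | atom a => rfl
  | nextF _ ih => rw [nextF_mem_canon, ← ih]; rfl
  | nextP _ ih => rw [nextP_mem_canon, ← ih]; rfl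
  | boxF _ ih => simp only [boxF_mem_canon, ← ih]; rfl
  | boxP _ ih => simp only [boxP_mem_canon, ← ih]; rfl

/-! ## Soundness of the closure and monotonicity of positive concepts -/

/-- The closure atoms that hold in an interpretation; `⊥` never does. -/
def trueAtoms (M : Itp) : Set EAtom :=
  {e | ∃ C n, n ∈ TC.sem M C ∧ e = EAtom.conc C n}

theorem conc_mem_trueAtoms {M : Itp} {C : TC} {n : ℤ} :
    EAtom.conc C n ∈ trueAtoms M ↔ n ∈ TC.sem M C := by
  simp [trueAtoms]

theorem bot_notMem_trueAtoms (M : Itp) : EAtom.bot ∉ trueAtoms M := by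
  simp [trueAtoms]

theorem clStep_subset_trueAtoms {O : Ontology} {M : Itp} (hM : ∀ cl ∈ O, cl.holds M)
    {Λ : Set EAtom} (hΛ : Λ ⊆ trueAtoms M) : clStep O Λ ⊆ trueAtoms M := by
  have hsem : ∀ {C : TC} {n : ℤ}, EAtom.conc C n ∈ Λ → n ∈ TC.sem M C :=
    fun h => conc_mem_trueAtoms.1 (hΛ h)
  rintro e (((((((((he | ⟨cl, hcl, n, hp, he⟩) | ⟨C, n, k, hk, h, rfl⟩) | ⟨C, n, h, rfl⟩) |
    ⟨C, n, h, rfl⟩) | ⟨C, n, h, rfl⟩) | ⟨C, n, k, hk, h, rfl⟩) | ⟨C, n, h, rfl⟩) |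
    ⟨C, n, h, rfl⟩) | ⟨C, n, h, rfl⟩)
  · exact hΛ he
  · obtain ⟨D, hD, hn⟩ := hM cl hcl n fun D hD => hsem (hp D hD)
    rcases he with ⟨C, hC, rfl⟩ | ⟨hC, -⟩
    · rw [hC, List.mem_singleton] at hD
      exact conc_mem_trueAtoms.2 (hD ▸ hn)
    · simp [hC] at hD
  · exact conc_mem_trueAtoms.2 (hsem h k hk)
  · exact conc_mem_trueAtoms.2 fun k hk => hsem (h k hk)
  · exact conc_mem_trueAtoms.2 (show n ∈ TC.sem M (.nextF C) from hsem h)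
  · exact conc_mem_trueAtoms.2 (show n + 1 ∈ TC.sem M C from hsem h)
  · exact conc_mem_trueAtoms.2 (hsem h k hk)
  · exact conc_mem_trueAtoms.2 fun k hk => hsem (h k hk)
  · exact conc_mem_trueAtoms.2 (show n ∈ TC.sem M (.nextP C) from hsem h)
  · exact conc_mem_trueAtoms.2 (show n - 1 ∈ TC.sem M C from hsem h)

theorem canon_subset_trueAtoms {O : Ontology} {A : DataInstance} {M : Itp} (hM : IsModel M O A) :
    canon O A ⊆ trueAtoms M := by
  suffices h : ∀ o, clIter O (dataAtoms A) o ⊆ trueAtoms M from h _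
  intro o
  induction o using Ordinal.limitRecOn with
  | zero =>
    rw [clIter_zero]
    rintro _ ⟨p, hp, rfl⟩
    exact conc_mem_trueAtoms.2 (hM.2 p hp)
  | add_one o ih =>
    rw [clIter_add_one]
    exact clStep_subset_trueAtoms hM.1 ih
  | limit o ho ih =>
    intro e he
    obtain ⟨o', ho', he⟩ := (mem_clIter_limit ho).1 he
    exact ih o' ho' he

theorem isModel_canonItp {O : Ontology} (hO : O.HornBoxNext) {A : DataInstance}
    (hbot : EAtom.bot ∉ canon O A) : IsModel (canonItp O A) O A := by
  refine ⟨fun cl hcl n hp => ?_, fun p hp => mem_canon_of_mem_dataAtoms ⟨p, hp, rfl⟩⟩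
  obtain ⟨⟨hprem, hconcl⟩, hhorn⟩ := hO cl hcl
  have hp' : ∀ D ∈ cl.prem, EAtom.conc D n ∈ canon O A :=
    fun D hD => (mem_sem_canonItp_iff O A (hprem D hD) n).1 (hp D hD)
  rcases Nat.le_one_iff_eq_zero_or_eq_one.1 hhorn with h | h
  · exact absurd (bot_mem_canon_of_clause hcl (List.length_eq_zero_iff.1 h) hp') hbot
  · obtain ⟨C, hC⟩ := List.length_eq_one_iff.1 h
    have hCmem : C ∈ cl.concl := by simp [hC]
    exact ⟨C, hCmem, (mem_sem_canonItp_iff O A (hconcl C hCmem) n).2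
      (conc_mem_canon_of_clause hcl hC hp')⟩

theorem sem_mono {M₁ M₂ : Itp} (h : ∀ a, M₁ a ⊆ M₂ a) {κ : TC} (hκ : κ.IsPositive) :
    TC.sem M₁ κ ⊆ TC.sem M₂ κ := by
  induction hκ with
  | top => exact subset_rfl
  | atom a => exact h a
  | and _ _ ih₁ ih₂ => exact Set.inter_subset_inter ih₁ ih₂
  | or _ _ ih₁ ih₂ => exact Set.union_subset_union ih₁ ih₂
  | nextF _ ih => exact fun n hn => ih hn
  | nextP _ ih => exact fun n hn => ih hn
  | diamF _ ih => exact fun n ⟨k, hk, hC⟩ => ⟨k, hk, ih hC⟩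
  | diamP _ ih => exact fun n ⟨k, hk, hC⟩ => ⟨k, hk, ih hC⟩
  | boxF _ ih => exact fun n hn k hk => ih (hn k hk)
  | boxP _ ih => exact fun n hn k hk => ih (hn k hk)
  | untl _ _ ih₁ ih₂ =>
    exact fun n ⟨k, hk, hD, hC⟩ => ⟨k, hk, ih₂ hD, fun m h₁ h₂ => ih₁ (hC m h₁ h₂)⟩
  | since _ _ ih₁ ih₂ =>
    exact fun n ⟨k, hk, hD, hC⟩ => ⟨k, hk, ih₂ hD, fun m h₁ h₂ => ih₁ (hC m h₁ h₂)⟩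

/-- properties of the canonical model of an LTL_horn^□○
ontology and a data instance. -/
theorem canonical_model_properties (O : Ontology) (hO : O.HornBoxNext) (A : DataInstance) :
    (∀ C : TC, C.IsBasic → ∀ n : ℤ,
        n ∈ TC.sem (canonItp O A) C ↔ EAtom.conc C n ∈ canon O A) ∧
    (∀ M : Itp, IsModel M O A → ∀ C : TC, C.IsBasic → ∀ n : ℤ,
        EAtom.conc C n ∈ canon O A → n ∈ TC.sem M C) ∧
    (EAtom.bot ∈ canon O A → ¬ ConsistentWith O A) ∧
    (EAtom.bot ∉ canon O A → IsModel (canonItp O A) O A) ∧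
    (ConsistentWith O A → ∀ κ : TC, κ.IsPositive →
        certAnsZ O κ A = TC.sem (canonItp O A) κ) := by
  have hsound : ∀ M : Itp, IsModel M O A → ∀ (C : TC) (n : ℤ),
      EAtom.conc C n ∈ canon O A → n ∈ TC.sem M C :=
    fun M hM C n h => conc_mem_trueAtoms.1 (canon_subset_trueAtoms hM h)
  have hbot : EAtom.bot ∈ canon O A → ¬ ConsistentWith O A :=
    fun h ⟨M, hM⟩ => bot_notMem_trueAtoms M (canon_subset_trueAtoms hM h)
  refine ⟨fun C hC n => mem_sem_canonItp_iff O A hC n, fun M hM C _ n => hsound M hM C n, hbot,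
    isModel_canonItp hO, fun hcons κ hκ => Set.Subset.antisymm
      (fun n hn => hn _ (isModel_canonItp hO fun h => hbot h hcons))
      fun n hn M hM => sem_mono (fun a k hk => hsound M hM (.atom a) k hk) hκ hn⟩

end LTLOMQ
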